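/- Let φ, ψ : U^n → U^n be holomorphic, and suppose the difference of composition operators C_φ − C_ψ : B → H^∞, f ↦ f∘φ − f∘ψ, is a bounded linear operator from the Bloch space B of U^n to H^∞(U^n). Then C_φ − C_ψ is compact if and only if lim_{δ→0⁺} sup_{z∈E_δ} |||φ_{φ(z)}(ψ(z))||| = 0, where E_δ = {z ∈ U^n : max(|||φ(z)|||, |||ψ(z)|||) > 1 − δ} and φ_a denotes the Möbius automorphism of U^n associated to a. -/

import Mathlib

open Complex Metric Set Filter
open scoped Topology BigOperators

noncomputable section

/-- The unit polydisc `U^n` in `ℂ^n`; the norm on `Fin n → ℂ` is the sup norm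
`|||z||| = max_j |z_j|`. -/
def polyDisc (n : ℕ) : Set (Fin n → ℂ) := {z | ‖z‖ < 1}

/-- `Σ_{j=1}^n (1 - |z_j|²) |∂f/∂z_j(z)|`. -/
def blochSum (n : ℕ) (f : (Fin n → ℂ) → ℂ) (z : Fin n → ℂ) : ℝ :=
  ∑ j : Fin n, (1 - ‖z j‖ ^ 2) * ‖fderiv ℂ f z (Pi.single j 1)‖

/-- The Bloch norm `‖f‖ = |f(0)| + sup_{z ∈ Uⁿ} Σ_j (1-|z_j|²)|∂f/∂z_j(z)|`. -/
def blochNorm (n : ℕ) (f : (Fin n → ℂ) → ℂ) : ℝ :=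
  ‖f 0‖ + sSup (blochSum n f '' polyDisc n)

/-- Membership in the Bloch space of `Uⁿ`: holomorphic on `Uⁿ` with finite Bloch norm. -/
def InBloch (n : ℕ) (f : (Fin n → ℂ) → ℂ) : Prop :=
  DifferentiableOn ℂ f (polyDisc n) ∧ BddAbove (blochSum n f '' polyDisc n)

/-- The Möbius automorphism `φ_a` of the polydisc:
`φ_a(w)_j = (w_j - a_j)/(1 - conj(a_j) w_j)`. -/
def mobius (n : ℕ) (a w : Fin n → ℂ) : Fin n → ℂ :=
  fun j => (w j - a j) / (1 - (starRingEnd ℂ) (a j) * w j)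

/-- The Kobayashi distance on the polydisc:
`k_{Uⁿ}(z,w) = (1/2) log((1 + |||φ_z(w)|||)/(1 - |||φ_z(w)|||))`. -/
def kobayashi (n : ℕ) (z w : Fin n → ℂ) : ℝ :=
  (1 / 2) * Real.log ((1 + ‖mobius n z w‖) / (1 - ‖mobius n z w‖))

/-- The `H^∞` (sup) norm of `g` over the polydisc: `‖g‖_∞ = sup_{z ∈ Uⁿ} |g(z)|`. -/
def supNorm (n : ℕ) (g : (Fin n → ℂ) → ℂ) : ℝ :=
  ⨆ z : polyDisc n, ‖g (z : Fin n → ℂ)‖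

/-- The difference of composition operators `C_φ - C_ψ : f ↦ f∘φ - f∘ψ`. -/
def compOpDiff (n : ℕ) (φ ψ : (Fin n → ℂ) → Fin n → ℂ) :
    ((Fin n → ℂ) → ℂ) → (Fin n → ℂ) → ℂ :=
  fun f => f ∘ φ - f ∘ ψ

/-- Boundedness of an operator from the Bloch space to `H^∞`. -/
def IsBddOp (n : ℕ) (T : ((Fin n → ℂ) → ℂ) → (Fin n → ℂ) → ℂ) : Prop :=
  ∃ C : ℝ, ∀ f, InBloch n f → supNorm n (T f) ≤ C * blochNorm n f

/-- The operator norm of `T` from the Bloch space to `H^∞`: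
the supremum of `‖T f‖_∞` over the unit ball of the Bloch space. -/
def opNorm (n : ℕ) (T : ((Fin n → ℂ) → ℂ) → (Fin n → ℂ) → ℂ) : ℝ :=
  sSup {t : ℝ | ∃ f, InBloch n f ∧ blochNorm n f ≤ 1 ∧ t = supNorm n (T f)}

/-- `T` is linear on the Bloch space (values only matter on the polydisc). -/
def IsLinOp (n : ℕ) (T : ((Fin n → ℂ) → ℂ) → (Fin n → ℂ) → ℂ) : Prop :=
  (∀ f g, InBloch n f → InBloch n g →
    ∀ z ∈ polyDisc n, T (f + g) z = T f z + T g z) ∧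
  (∀ (c : ℂ) (f), InBloch n f → ∀ z ∈ polyDisc n, T (c • f) z = c * T f z)

/-- `T` sends Bloch functions to `H^∞` functions (bounded and holomorphic on `Uⁿ`). -/
def MapsToHinf (n : ℕ) (T : ((Fin n → ℂ) → ℂ) → (Fin n → ℂ) → ℂ) : Prop :=
  ∀ f, InBloch n f → DifferentiableOn ℂ (T f) (polyDisc n) ∧
    BddAbove ((fun z => ‖T f z‖) '' polyDisc n)

/-- Compactness of a linear operator `T` from the Bloch space to `H^∞`:
every sequence in the unit ball of the Bloch space has a subsequence whose image
under `T` is Cauchy in the `H^∞` norm. -/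
def IsCompactOp (n : ℕ) (T : ((Fin n → ℂ) → ℂ) → (Fin n → ℂ) → ℂ) : Prop :=
  IsLinOp n T ∧ MapsToHinf n T ∧
  ∀ F : ℕ → (Fin n → ℂ) → ℂ, (∀ m, InBloch n (F m) ∧ blochNorm n (F m) ≤ 1) →
    ∃ s : ℕ → ℕ, StrictMono s ∧
      ∀ ε : ℝ, 0 < ε → ∃ N : ℕ, ∀ k ≥ N, ∀ k' ≥ N,
        supNorm n (T (F (s k)) - T (F (s k'))) ≤ ε

/-- The essential norm of `T : B → H^∞`: the distance from `T` to the compact operators,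
`‖T‖_e = inf {‖T - K‖ : K compact}`. -/
def essNorm (n : ℕ) (T : ((Fin n → ℂ) → ℂ) → (Fin n → ℂ) → ℂ) : ℝ :=
  sInf {t : ℝ | ∃ K, IsCompactOp n K ∧ t = opNorm n (T - K)}

/-- `E_δ = {z ∈ Uⁿ : max(|||φ(z)|||, |||ψ(z)|||) > 1 - δ}`. -/
def Eset (n : ℕ) (φ ψ : (Fin n → ℂ) → Fin n → ℂ) (δ : ℝ) : Set (Fin n → ℂ) :=
  {z ∈ polyDisc n | 1 - δ < max ‖φ z‖ ‖ψ z‖}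

section Polydisc

variable {n : ℕ}

lemma polyDisc_eq_ball : polyDisc n = ball 0 1 := by
  ext z
  simp [polyDisc]

lemma isOpen_polyDisc : IsOpen (polyDisc n) := by
  rw [polyDisc_eq_ball]
  exact isOpen_ball

lemma convex_polyDisc : Convex ℝ (polyDisc n) := by
  rw [polyDisc_eq_ball]
  exact convex_ball 0 1

lemma norm_coord_lt_one {z : Fin n → ℂ} (hz : z ∈ polyDisc n) (j : Fin n) : ‖z j‖ < 1 :=
  (norm_le_pi_norm z j).trans_lt hz

lemma one_sub_conj_mul_ne_zero {a w : ℂ} (ha : ‖a‖ < 1) (hw : ‖w‖ < 1) :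
    1 - (starRingEnd ℂ) a * w ≠ 0 := by
  intro h
  have h1 : ‖(starRingEnd ℂ) a * w‖ = 1 := by
    rw [← sub_eq_zero.mp h, norm_one]
  rw [norm_mul, RCLike.norm_conj] at h1
  nlinarith [norm_nonneg a, norm_nonneg w]

lemma norm_sub_le_norm_one_sub_conj_mul {a w : ℂ} (ha : ‖a‖ < 1) (hw : ‖w‖ < 1) :
    ‖w - a‖ ≤ ‖1 - (starRingEnd ℂ) a * w‖ := by
  have key : ‖1 - (starRingEnd ℂ) a * w‖ ^ 2 - ‖w - a‖ ^ 2
      = (1 - ‖a‖ ^ 2) * (1 - ‖w‖ ^ 2) := by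
    simp only [Complex.sq_norm, Complex.normSq_apply]
    simp
    ring
  have h : 0 ≤ (1 - ‖a‖ ^ 2) * (1 - ‖w‖ ^ 2) :=
    mul_nonneg (by nlinarith [norm_nonneg a]) (by nlinarith [norm_nonneg w])
  exact (sq_le_sq₀ (norm_nonneg _) (norm_nonneg _)).mp (by linarith)

lemma norm_mobius_coord_le_one {a w : Fin n → ℂ} (ha : a ∈ polyDisc n) (hw : w ∈ polyDisc n)
    (j : Fin n) : ‖mobius n a w j‖ ≤ 1 := by
  rw [mobius, norm_div]
  exact div_le_one_of_le₀ (norm_sub_le_norm_one_sub_conj_mul (norm_coord_lt_one ha j)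
    (norm_coord_lt_one hw j)) (norm_nonneg _)

lemma norm_mobius_le_one {a w : Fin n → ℂ} (ha : a ∈ polyDisc n) (hw : w ∈ polyDisc n) :
    ‖mobius n a w‖ ≤ 1 :=
  (pi_norm_le_iff_of_nonneg zero_le_one).mpr (norm_mobius_coord_le_one ha hw)

lemma norm_mobius_comm (a w : Fin n → ℂ) : ‖mobius n a w‖ = ‖mobius n w a‖ := by
  have h (j : Fin n) : ‖mobius n a w j‖ = ‖mobius n w a j‖ := by
    simp only [mobius, norm_div]
    rw [norm_sub_rev, ← RCLike.norm_conj (1 - (starRingEnd ℂ) (a j) * w j)]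
    simp [mul_comm]
  simp only [Pi.norm_def]
  congr 2
  ext j
  exact h j

lemma fderiv_apply_eq_sum (f : (Fin n → ℂ) → ℂ) (p v : Fin n → ℂ) :
    fderiv ℂ f p v = ∑ j, v j * fderiv ℂ f p (Pi.single j 1) := by
  have hv : v = ∑ j, v j • (Pi.single j 1 : Fin n → ℂ) := by
    ext i
    simp [Finset.sum_apply, Pi.single_apply]
  conv_lhs => rw [hv]
  simp [map_sum]

lemma one_sub_sq_norm_nonneg {z : Fin n → ℂ} (hz : z ∈ polyDisc n) (j : Fin n) :
    0 ≤ 1 - ‖z j‖ ^ 2 := by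
  nlinarith [norm_coord_lt_one hz j, norm_nonneg (z j)]

lemma blochSum_nonneg (f : (Fin n → ℂ) → ℂ) {z : Fin n → ℂ} (hz : z ∈ polyDisc n) :
    0 ≤ blochSum n f z :=
  Finset.sum_nonneg fun j _ => mul_nonneg (one_sub_sq_norm_nonneg hz j) (norm_nonneg _)

lemma InBloch.blochSum_le {f : (Fin n → ℂ) → ℂ} (hf : InBloch n f) {z : Fin n → ℂ}
    (hz : z ∈ polyDisc n) : blochSum n f z ≤ blochNorm n f :=
  (le_csSup hf.2 (mem_image_of_mem _ hz)).trans (le_add_of_nonneg_left (norm_nonneg _))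

lemma blochNorm_nonneg (f : (Fin n → ℂ) → ℂ) : 0 ≤ blochNorm n f :=
  add_nonneg (norm_nonneg _) <| Real.sSup_nonneg <| by
    rintro _ ⟨z, hz, rfl⟩
    exact blochSum_nonneg f hz

lemma norm_apply_zero_le_blochNorm (f : (Fin n → ℂ) → ℂ) : ‖f 0‖ ≤ blochNorm n f :=
  le_add_of_nonneg_right <| Real.sSup_nonneg <| by
    rintro _ ⟨z, hz, rfl⟩
    exact blochSum_nonneg f hz

/-- Mean value inequality for Bloch functions along the segment from `a` to `b`. -/
lemma InBloch.norm_sub_le_mul_blochNorm {f : (Fin n → ℂ) → ℂ} (hf : InBloch n f) {a b : Fin n → ℂ}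
    (ha : a ∈ polyDisc n) (hb : b ∈ polyDisc n) {K : ℝ} (hK : 0 ≤ K)
    (h : ∀ t ∈ Icc (0 : ℝ) 1, ∀ j, ‖b j - a j‖ ≤ K * (1 - ‖(a + t • (b - a)) j‖ ^ 2)) :
    ‖f b - f a‖ ≤ K * blochNorm n f := by
  have hmem : ∀ t ∈ Icc (0 : ℝ) 1, a + t • (b - a) ∈ polyDisc n := fun t ht =>
    convex_polyDisc.add_smul_sub_mem ha hb ht
  have hderiv : ∀ t ∈ Icc (0 : ℝ) 1, HasDerivWithinAt (fun t : ℝ => f (a + t • (b - a)))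
      (fderiv ℂ f (a + t • (b - a)) (b - a)) (Icc 0 1) t := by
    intro t ht
    have h1 : HasFDerivAt f ((fderiv ℂ f (a + t • (b - a))).restrictScalars ℝ)
        (a + t • (b - a)) :=
      ((hf.1.differentiableAt (isOpen_polyDisc.mem_nhds (hmem t ht))).hasFDerivAt).restrictScalars ℝ
    have h2 : HasDerivAt (fun t : ℝ => a + t • (b - a)) (b - a) t := by
      simpa using ((hasDerivAt_id t).smul_const (b - a)).const_add a
    exact (h1.comp_hasDerivAt t h2).hasDerivWithinAt
  have hbound : ∀ t ∈ Ico (0 : ℝ) 1,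
      ‖fderiv ℂ f (a + t • (b - a)) (b - a)‖ ≤ K * blochNorm n f := by
    intro t ht
    have ht' := Ico_subset_Icc_self ht
    rw [fderiv_apply_eq_sum]
    calc _ ≤ ∑ j, ‖(b - a) j * fderiv ℂ f (a + t • (b - a)) (Pi.single j 1)‖ := norm_sum_le _ _
      _ ≤ ∑ j, K * ((1 - ‖(a + t • (b - a)) j‖ ^ 2)
            * ‖fderiv ℂ f (a + t • (b - a)) (Pi.single j 1)‖) := by
          refine Finset.sum_le_sum fun j _ => ?_
          rw [norm_mul, ← mul_assoc]
          exact mul_le_mul_of_nonneg_right (h t ht' j) (norm_nonneg _)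
      _ = K * blochSum n f (a + t • (b - a)) := by rw [← Finset.mul_sum, blochSum]
      _ ≤ K * blochNorm n f := mul_le_mul_of_nonneg_left (hf.blochSum_le (hmem t ht')) hK
  simpa using norm_image_sub_le_of_norm_deriv_le_segment_01' hderiv hbound

lemma InBloch.norm_sub_le_of_norm_le {f : (Fin n → ℂ) → ℂ} (hf : InBloch n f) {r : ℝ} (hr : r < 1)
    {a b : Fin n → ℂ} (ha : ‖a‖ ≤ r) (hb : ‖b‖ ≤ r) :
    ‖f b - f a‖ ≤ ‖b - a‖ / (1 - r) * blochNorm n f := by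
  have hr' : 0 < 1 - r := by linarith
  refine hf.norm_sub_le_mul_blochNorm (ha.trans_lt hr) (hb.trans_lt hr)
    (div_nonneg (norm_nonneg _) hr'.le) fun t ht j => ?_
  have hmem : a + t • (b - a) ∈ closedBall (0 : Fin n → ℂ) r :=
    (convex_closedBall 0 r).add_smul_sub_mem (by simpa using ha) (by simpa using hb) ht
  have hj : ‖(a + t • (b - a)) j‖ ≤ r :=
    (norm_le_pi_norm _ j).trans (by simpa using hmem)
  have h0 := norm_nonneg ((a + t • (b - a)) j)
  calc ‖b j - a j‖ ≤ ‖b - a‖ := norm_le_pi_norm (b - a) j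
    _ = ‖b - a‖ / (1 - r) * (1 - r) := by field_simp
    _ ≤ _ := mul_le_mul_of_nonneg_left (by nlinarith) (div_nonneg (norm_nonneg _) hr'.le)

lemma InBloch.norm_sub_le_of_norm_mobius_le {f : (Fin n → ℂ) → ℂ} (hf : InBloch n f)
    {a b : Fin n → ℂ} (ha : a ∈ polyDisc n) (hb : b ∈ polyDisc n) {ρ : ℝ} (hρ : ρ ≤ 1 / 8)
    (h : ‖mobius n a b‖ ≤ ρ) : ‖f b - f a‖ ≤ 8 * ρ * blochNorm n f := by
  have hρ0 : 0 ≤ ρ := (norm_nonneg _).trans h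
  refine hf.norm_sub_le_mul_blochNorm ha hb (by linarith) fun t ht j => ?_
  have haj := norm_coord_lt_one ha j
  have hbj := norm_coord_lt_one hb j
  have hm : ‖b j - a j‖ ≤ ρ * ‖1 - (starRingEnd ℂ) (a j) * b j‖ := by
    have h1 := (norm_le_pi_norm _ j).trans h
    rw [mobius, norm_div] at h1
    exact (div_le_iff₀ (norm_pos_iff.mpr (one_sub_conj_mul_ne_zero haj hbj))).mp h1
  have hden : ‖1 - (starRingEnd ℂ) (a j) * b j‖ ≤ (1 - ‖a j‖ ^ 2) + ‖b j - a j‖ := by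
    have h2 : 1 - (starRingEnd ℂ) (a j) * b j
        = ((1 - ‖a j‖ ^ 2 : ℝ) : ℂ) - (starRingEnd ℂ) (a j) * (b j - a j) := by
      push_cast
      rw [← Complex.conj_mul']
      ring
    rw [h2]
    refine (norm_sub_le _ _).trans ?_
    rw [Complex.norm_of_nonneg (one_sub_sq_norm_nonneg ha j), norm_mul, RCLike.norm_conj]
    nlinarith [norm_nonneg (b j - a j)]
  have h0 := norm_nonneg (b j - a j)
  have ha0 := norm_nonneg (a j)
  have hdist : ‖b j - a j‖ ≤ 2 * ρ * (1 - ‖a j‖ ^ 2) := by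
    have := mul_le_mul_of_nonneg_left hden hρ0
    nlinarith
  have hp : ‖(a + t • (b - a)) j‖ ≤ ‖a j‖ + ‖b j - a j‖ := by
    simp only [Pi.add_apply, Pi.smul_apply, Pi.sub_apply]
    refine (norm_add_le _ _).trans ?_
    rw [norm_smul, Real.norm_of_nonneg ht.1]
    nlinarith [ht.2]
  have hp0 := norm_nonneg ((a + t • (b - a)) j)
  have hdist' : ‖b j - a j‖ ≤ (1 - ‖a j‖) / 2 := by
    have := mul_le_mul_of_nonneg_right hρ (one_sub_sq_norm_nonneg ha j)
    nlinarith
  have hp1 : 1 - ‖a j‖ ≤ 2 * (1 - ‖(a + t • (b - a)) j‖) := by linarith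
  have hp2 : 1 - ‖a j‖ ^ 2 ≤ 4 * (1 - ‖(a + t • (b - a)) j‖ ^ 2) := by nlinarith
  nlinarith

lemma norm_fderiv_single_le {f : (Fin n → ℂ) → ℂ} (hf : DifferentiableOn ℂ f (polyDisc n))
    {M : ℝ} (hM : ∀ w ∈ polyDisc n, ‖f w‖ ≤ M) {z : Fin n → ℂ} (hz : z ∈ polyDisc n)
    (j : Fin n) : ‖fderiv ℂ f z (Pi.single j 1)‖ ≤ M / ((1 - ‖z j‖) / 2) := by
  have hzj := norm_coord_lt_one hz j
  set R : ℝ := (1 - ‖z j‖) / 2 with hR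
  have hR0 : 0 < R := by linarith
  have hmem : ∀ ζ ∈ closedBall (0 : ℂ) R, z + ζ • (Pi.single j 1 : Fin n → ℂ) ∈ polyDisc n := by
    intro ζ hζ
    refine (pi_norm_lt_iff zero_lt_one).mpr fun i => ?_
    by_cases hij : i = j
    · subst hij
      have h1 : ‖ζ‖ ≤ R := by simpa using hζ
      simpa using (norm_add_le (z i) ζ).trans_lt (by linarith)
    · simpa [hij] using norm_coord_lt_one hz i
  have hline (ζ : ℂ) : HasDerivAt (fun ζ : ℂ => z + ζ • (Pi.single j 1 : Fin n → ℂ))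
      (Pi.single j 1) ζ := by
    simpa using ((hasDerivAt_id ζ).smul_const (Pi.single j 1 : Fin n → ℂ)).const_add z
  have hd : DifferentiableOn ℂ (fun ζ : ℂ => f (z + ζ • (Pi.single j 1 : Fin n → ℂ)))
      (closedBall 0 R) :=
    hf.comp (fun ζ _ => (hline ζ).differentiableAt.differentiableWithinAt) hmem
  have hz' : z + (0 : ℂ) • (Pi.single j 1 : Fin n → ℂ) = z := by simp
  have hderiv : deriv (fun ζ : ℂ => f (z + ζ • (Pi.single j 1 : Fin n → ℂ))) 0
      = fderiv ℂ f z (Pi.single j 1) := by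
    have h1 : HasFDerivAt f (fderiv ℂ f z) (z + (0 : ℂ) • (Pi.single j 1 : Fin n → ℂ)) := by
      rw [hz']
      exact (hf.differentiableAt (isOpen_polyDisc.mem_nhds hz)).hasFDerivAt
    exact (h1.comp_hasDerivAt (0 : ℂ) (hline 0)).deriv
  rw [← hderiv]
  exact Complex.norm_deriv_le_of_forall_mem_sphere_norm_le hR0
    (hd.diffContOnCl_ball subset_rfl)
    fun ζ hζ => hM _ (hmem ζ (sphere_subset_closedBall hζ))

/-- Bounded holomorphic functions are Bloch functions. -/
lemma blochSum_le_of_norm_le {f : (Fin n → ℂ) → ℂ} (hf : DifferentiableOn ℂ f (polyDisc n))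
    {M : ℝ} (hM0 : 0 ≤ M) (hM : ∀ w ∈ polyDisc n, ‖f w‖ ≤ M) {z : Fin n → ℂ}
    (hz : z ∈ polyDisc n) : blochSum n f z ≤ n * (4 * M) := by
  have h : ∀ j ∈ (Finset.univ : Finset (Fin n)),
      (1 - ‖z j‖ ^ 2) * ‖fderiv ℂ f z (Pi.single j 1)‖ ≤ 4 * M := by
    intro j _
    have hzj := norm_coord_lt_one hz j
    have h0 := norm_nonneg (z j)
    calc _ ≤ (1 - ‖z j‖ ^ 2) * (M / ((1 - ‖z j‖) / 2)) :=
          mul_le_mul_of_nonneg_left (norm_fderiv_single_le hf hM hz j)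
            (one_sub_sq_norm_nonneg hz j)
      _ = 2 * (1 + ‖z j‖) * M := by
          have : 1 - ‖z j‖ ≠ 0 := by linarith
          field_simp
          ring
      _ ≤ 4 * M := by nlinarith
  simpa [blochSum] using Finset.sum_le_sum h

lemma inBloch_of_norm_le {f : (Fin n → ℂ) → ℂ} (hf : DifferentiableOn ℂ f (polyDisc n))
    {M : ℝ} (hM0 : 0 ≤ M) (hM : ∀ w ∈ polyDisc n, ‖f w‖ ≤ M) :
    InBloch n f ∧ blochNorm n f ≤ M + n * (4 * M) := by
  have h0 : (0 : Fin n → ℂ) ∈ polyDisc n := by simp [polyDisc]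
  refine ⟨⟨hf, ⟨n * (4 * M), ?_⟩⟩, add_le_add (hM 0 h0) (csSup_le ⟨_, mem_image_of_mem _ h0⟩ ?_)⟩
  all_goals
    rintro _ ⟨z, hz, rfl⟩
    exact blochSum_le_of_norm_le hf hM0 hM hz

/-- A function bounded by `2`, small away from the boundary when `a` is close to it, which
separates `a` from `b` by their pseudohyperbolic distance. -/
lemma exists_separating_function (hn : 0 < n) {a b : Fin n → ℂ} (ha : a ∈ polyDisc n)
    (hb : b ∈ polyDisc n) :
    ∃ f : (Fin n → ℂ) → ℂ, DifferentiableOn ℂ f (polyDisc n) ∧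
      (∀ w ∈ polyDisc n, ‖f w‖ ≤ 2) ∧
      (∀ w ∈ polyDisc n, ‖f w‖ ≤ 2 * (1 - ‖a‖) / (1 - ‖w‖)) ∧
      ‖f a - f b‖ = ‖mobius n a b‖ := by
  have : Nonempty (Fin n) := ⟨⟨0, hn⟩⟩
  obtain ⟨j, hj⟩ : ∃ j, ‖a‖ = ‖a j‖ := by
    obtain ⟨j, hj⟩ := Finite.exists_max fun j => ‖a j‖
    exact ⟨j, le_antisymm ((pi_norm_le_iff_of_nonempty _).mpr hj) (norm_le_pi_norm a j)⟩
  obtain ⟨k, hk⟩ : ∃ k, ‖mobius n b a‖ = ‖mobius n b a k‖ := by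
    obtain ⟨k, hk⟩ := Finite.exists_max fun k => ‖mobius n b a k‖
    exact ⟨k, le_antisymm ((pi_norm_le_iff_of_nonempty _).mpr hk) (norm_le_pi_norm _ k)⟩
  have haj := norm_coord_lt_one ha j
  have ha0 := norm_nonneg (a j)
  have hnum : ‖((1 - ‖a j‖ ^ 2 : ℝ) : ℂ)‖ = 1 - ‖a j‖ ^ 2 :=
    Complex.norm_of_nonneg (one_sub_sq_norm_nonneg ha j)
  have hlow (w : Fin n → ℂ) : 1 - ‖a j‖ * ‖w j‖ ≤ ‖1 - (starRingEnd ℂ) (a j) * w j‖ := by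
    have := norm_sub_norm_le (1 : ℂ) ((starRingEnd ℂ) (a j) * w j)
    rwa [norm_one, norm_mul, RCLike.norm_conj] at this
  have hle {w : Fin n → ℂ} (hw : w ∈ polyDisc n) {c : ℝ} (hc : 0 < c)
      (hcw : c ≤ 1 - ‖a j‖ * ‖w j‖) :
      ‖((1 - ‖a j‖ ^ 2 : ℝ) : ℂ) / (1 - (starRingEnd ℂ) (a j) * w j) * mobius n b w k‖
        ≤ 2 * (1 - ‖a j‖) / c := by
    rw [norm_mul, norm_div, hnum]
    refine (mul_le_of_le_one_right (div_nonneg (one_sub_sq_norm_nonneg ha j) (norm_nonneg _))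
      (norm_mobius_coord_le_one hb hw k)).trans ?_
    exact div_le_div₀ (by linarith) (by nlinarith) hc (hcw.trans (hlow w))
  refine ⟨fun w => ((1 - ‖a j‖ ^ 2 : ℝ) : ℂ) / (1 - (starRingEnd ℂ) (a j) * w j)
    * mobius n b w k, ?_, fun w hw => ?_, fun w hw => ?_, ?_⟩
  · intro w hw
    have h1 := one_sub_conj_mul_ne_zero haj (norm_coord_lt_one hw j)
    have h2 := one_sub_conj_mul_ne_zero (norm_coord_lt_one hb k) (norm_coord_lt_one hw k)
    unfold mobius
    apply DifferentiableAt.differentiableWithinAt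
    fun_prop (disch := assumption)
  · have hwj := norm_coord_lt_one hw j
    refine (hle hw (c := 1 - ‖a j‖) (by linarith) (by nlinarith)).trans_eq ?_
    have : 1 - ‖a j‖ ≠ 0 := by linarith
    field_simp
  · have hw1 : ‖w‖ < 1 := hw
    have hwj := norm_le_pi_norm w j
    rw [hj]
    exact hle hw (by linarith) (by nlinarith [norm_nonneg (w j)])
  · have h1 : mobius n b b k = 0 := by simp [mobius]
    have h2 : ((1 - ‖a j‖ ^ 2 : ℝ) : ℂ) / (1 - (starRingEnd ℂ) (a j) * a j) = 1 := by
      have h3 := one_sub_conj_mul_ne_zero haj haj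
      rw [Complex.conj_mul'] at h3 ⊢
      push_cast
      exact div_self h3
    simp only [h1, h2, mul_zero, sub_zero, one_mul]
    rw [norm_mobius_comm, hk]

open scoped Pointwise in
lemma InBloch.const_smul {f : (Fin n → ℂ) → ℂ} (hf : InBloch n f) (c : ℂ) :
    InBloch n (c • f) ∧ blochNorm n (c • f) = ‖c‖ * blochNorm n f := by
  have hsum : blochSum n (c • f) '' polyDisc n = ‖c‖ • (blochSum n f '' polyDisc n) := by
    rw [← image_smul, image_image]
    refine image_congr fun z hz => ?_
    have hd := hf.1.differentiableAt (isOpen_polyDisc.mem_nhds hz)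
    simp only [blochSum, smul_eq_mul, Finset.mul_sum, fderiv_const_smul hd]
    refine Finset.sum_congr rfl fun j _ => ?_
    simp only [smul_apply, norm_smul]
    ring
  refine ⟨⟨hf.1.const_smul c, ?_⟩, ?_⟩
  · rw [hsum]
    exact hf.2.smul_of_nonneg (norm_nonneg c)
  · rw [blochNorm, blochNorm, hsum, Real.sSup_smul_of_nonneg (norm_nonneg c)]
    simp [mul_add]

lemma norm_le_supNorm {g : (Fin n → ℂ) → ℂ} (hg : BddAbove ((fun z => ‖g z‖) '' polyDisc n))
    {z : Fin n → ℂ} (hz : z ∈ polyDisc n) : ‖g z‖ ≤ supNorm n g := by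
  rw [image_eq_range] at hg
  exact le_ciSup hg ⟨z, hz⟩

/-- A Montel-type theorem for the unit ball of the Bloch space. -/
lemma exists_subseq_uniformCauchy {F : ℕ → (Fin n → ℂ) → ℂ}
    (hF : ∀ m, InBloch n (F m) ∧ blochNorm n (F m) ≤ 1) :
    ∃ s : ℕ → ℕ, StrictMono s ∧ ∀ r < 1, ∀ ε > 0, ∃ N, ∀ k ≥ N, ∀ k' ≥ N,
      ∀ w : Fin n → ℂ, ‖w‖ ≤ r → ‖F (s k) w - F (s k') w‖ ≤ ε := by
  have hlip {r : ℝ} (hr : r < 1) {a b : Fin n → ℂ} (ha : ‖a‖ ≤ r) (hb : ‖b‖ ≤ r) (m : ℕ) :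
      ‖F m b - F m a‖ ≤ ‖b - a‖ / (1 - r) :=
    ((hF m).1.norm_sub_le_of_norm_le hr ha hb).trans <|
      mul_le_of_le_one_right (div_nonneg (norm_nonneg _) (by linarith)) (hF m).2
  have : Nonempty (polyDisc n) := ⟨⟨0, by simp [polyDisc]⟩⟩
  let d : ℕ → polyDisc n := TopologicalSpace.denseSeq (polyDisc n)
  have hd : DenseRange d := TopologicalSpace.denseRange_denseSeq _
  let R : ℕ → ℝ := fun i => 1 + 1 / (1 - ‖(d i : Fin n → ℂ)‖)
  have hcpt : IsCompact (univ.pi fun i => closedBall (0 : ℂ) (R i)) :=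
    isCompact_univ_pi fun i => isCompact_closedBall _ _
  have hmem (m : ℕ) : (fun i => F m (d i)) ∈ univ.pi fun i => closedBall (0 : ℂ) (R i) := by
    intro i _
    have hi : ‖(d i : Fin n → ℂ)‖ < 1 := (d i).2
    have h1 := hlip hi (a := 0) (b := d i) (by simp) le_rfl m
    have h2 := (norm_apply_zero_le_blochNorm (F m)).trans (hF m).2
    have h3 := norm_le_norm_add_norm_sub' (F m (d i)) (F m 0)
    have h4 : ‖(d i : Fin n → ℂ) - 0‖ / (1 - ‖(d i : Fin n → ℂ)‖)
        ≤ 1 / (1 - ‖(d i : Fin n → ℂ)‖) := by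
      rw [sub_zero]
      exact div_le_div_of_nonneg_right hi.le (by linarith)
    simp only [mem_closedBall, dist_zero_right, R]
    linarith
  obtain ⟨x, -, s, hs, hx⟩ := hcpt.tendsto_subseq hmem
  rw [tendsto_pi_nhds] at hx
  refine ⟨s, hs, fun r hr ε hε => ?_⟩
  set r' : ℝ := (1 + r) / 2 with hr'
  have hr'1 : 0 < 1 - r' := by linarith
  set η : ℝ := min (ε / 3 * (1 - r')) (r' - r) with hη
  have hη0 : 0 < η := lt_min (by positivity) (by linarith)
  have hcov : closedBall (0 : Fin n → ℂ) r ⊆ ⋃ i, ball (d i : Fin n → ℂ) η := by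
    intro w hw
    have hw1 : ‖w‖ ≤ r := by simpa using hw
    obtain ⟨i, hi⟩ := hd.exists_dist_lt (⟨w, hw1.trans_lt hr⟩ : polyDisc n) hη0
    exact mem_iUnion.mpr ⟨i, hi⟩
  obtain ⟨t, ht⟩ := (isCompact_closedBall (0 : Fin n → ℂ) r).elim_finite_subcover _
    (fun i => isOpen_ball) hcov
  have hev : ∀ i ∈ t, ∃ N, ∀ k ≥ N, ∀ k' ≥ N,
      ‖F (s k) (d i) - F (s k') (d i)‖ < ε / 3 := by
    intro i _
    obtain ⟨N, hN⟩ := Metric.cauchySeq_iff.mp (hx i).cauchySeq (ε / 3) (by positivity)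
    exact ⟨N, fun k hk k' hk' => by simpa [dist_eq_norm] using hN k hk k' hk'⟩
  choose! N hN using hev
  refine ⟨t.sup N, fun k hk k' hk' w hw => ?_⟩
  obtain ⟨i, hit, hi⟩ := mem_iUnion₂.mp (ht (by simpa using hw : w ∈ closedBall 0 r))
  rw [mem_ball, dist_eq_norm] at hi
  have hdi : ‖(d i : Fin n → ℂ)‖ ≤ r' := by
    have h1 := norm_le_norm_add_norm_sub' (d i : Fin n → ℂ) w
    have h2 : η ≤ r' - r := min_le_right _ _
    rw [norm_sub_rev] at h1
    linarith
  have hclose (m : ℕ) : ‖F m w - F m (d i)‖ ≤ ε / 3 := by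
    refine (hlip (by linarith) hdi (by linarith) m).trans ?_
    rw [div_le_iff₀ hr'1]
    exact hi.le.trans (min_le_left _ _)
  have h1 := hclose (s k)
  have h2 := hclose (s k')
  have h3 := hN i hit k ((Finset.le_sup hit).trans hk) k' ((Finset.le_sup hit).trans hk')
  rw [norm_sub_rev] at h2
  calc ‖F (s k) w - F (s k') w‖
      = ‖(F (s k) w - F (s k) (d i)) + (F (s k) (d i) - F (s k') (d i))
          + (F (s k') (d i) - F (s k') w)‖ := by congr 1; ring
    _ ≤ _ := norm_add₃_le
    _ ≤ ε := by linarith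

section Difference

variable {φ ψ : (Fin n → ℂ) → Fin n → ℂ}

lemma isLinOp_compOpDiff : IsLinOp n (compOpDiff n φ ψ) := by
  constructor
  · intro f g _ _ z _
    simp only [compOpDiff, Pi.sub_apply, Function.comp_apply, Pi.add_apply]
    ring
  · intro c f _ z _
    simp only [compOpDiff, Pi.sub_apply, Function.comp_apply, Pi.smul_apply, smul_eq_mul]
    ring

lemma bddAbove_norm_mobius (hφm : MapsTo φ (polyDisc n) (polyDisc n))
    (hψm : MapsTo ψ (polyDisc n) (polyDisc n)) (δ : ℝ) :
    BddAbove ((fun z => ‖mobius n (φ z) (ψ z)‖) '' Eset n φ ψ δ) := by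
  refine ⟨1, ?_⟩
  rintro _ ⟨z, hz, rfl⟩
  exact norm_mobius_le_one (hφm hz.1) (hψm hz.1)

lemma isCompactOp_compOpDiff
    (hφ : DifferentiableOn ℂ φ (polyDisc n)) (hφm : MapsTo φ (polyDisc n) (polyDisc n))
    (hψ : DifferentiableOn ℂ ψ (polyDisc n)) (hψm : MapsTo ψ (polyDisc n) (polyDisc n))
    (h : ∀ ε > 0, ∃ δ > 0, ∀ z ∈ Eset n φ ψ δ, ‖mobius n (φ z) (ψ z)‖ ≤ ε) :
    IsCompactOp n (compOpDiff n φ ψ) := by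
  have hoff {δ : ℝ} {z : Fin n → ℂ} (hz : z ∈ polyDisc n) (hzE : z ∉ Eset n φ ψ δ) :
      ‖φ z‖ ≤ 1 - δ ∧ ‖ψ z‖ ≤ 1 - δ :=
    max_le_iff.mp (not_lt.mp fun hlt => hzE ⟨hz, hlt⟩)
  refine ⟨isLinOp_compOpDiff, fun f hf => ⟨(hf.1.comp hφ hφm).sub (hf.1.comp hψ hψm), ?_⟩, ?_⟩
  · obtain ⟨δ, hδ, hE⟩ := h (1 / 8) (by norm_num)
    refine ⟨max (8 * (1 / 8) * blochNorm n f) (2 / δ * blochNorm n f), ?_⟩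
    rintro _ ⟨z, hz, rfl⟩
    simp only [compOpDiff, Pi.sub_apply, Function.comp_apply]
    rw [norm_sub_rev]
    by_cases hzE : z ∈ Eset n φ ψ δ
    · exact le_max_of_le_left
        (hf.norm_sub_le_of_norm_mobius_le (hφm hz) (hψm hz) le_rfl (hE z hzE))
    · obtain ⟨h1, h2⟩ := hoff hz hzE
      refine le_max_of_le_right ((hf.norm_sub_le_of_norm_le (by linarith) h1 h2).trans ?_)
      rw [sub_sub_cancel]
      have h3 : ‖ψ z - φ z‖ ≤ 2 := (norm_sub_le _ _).trans (by linarith)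
      have h4 := blochNorm_nonneg f
      gcongr
  · intro F hF
    obtain ⟨s, hs, hs'⟩ := exists_subseq_uniformCauchy hF
    refine ⟨s, hs, fun ε hε => ?_⟩
    obtain ⟨δ, hδ, hE⟩ := h (min (1 / 8) (ε / 16)) (by positivity)
    obtain ⟨N, hN⟩ := hs' (1 - δ) (by linarith) (ε / 2) (by positivity)
    refine ⟨N, fun k hk k' hk' => Real.iSup_le (fun ⟨z, hz⟩ => ?_) hε.le⟩
    simp only [compOpDiff, Pi.sub_apply, Function.comp_apply]
    by_cases hzE : z ∈ Eset n φ ψ δ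
    · have hsmall (m : ℕ) : ‖F m (φ z) - F m (ψ z)‖ ≤ ε / 2 := by
        rw [norm_sub_rev]
        refine ((hF m).1.norm_sub_le_of_norm_mobius_le (hφm hz) (hψm hz) (min_le_left _ _)
          (hE z hzE)).trans ?_
        have h1 : min (1 / 8) (ε / 16) ≤ ε / 16 := min_le_right _ _
        exact (mul_le_of_le_one_right (by positivity) (hF m).2).trans (by linarith)
      exact (norm_sub_le _ _).trans (by linarith [hsmall (s k), hsmall (s k')])
    · obtain ⟨h1, h2⟩ := hoff hz hzE
      rw [sub_sub_sub_comm]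
      exact (norm_sub_le _ _).trans
        (by linarith [hN k hk k' hk' _ h1, hN k hk k' hk' _ h2])

lemma not_isCompactOp_compOpDiff (hn : 0 < n)
    (hφm : MapsTo φ (polyDisc n) (polyDisc n)) (hψm : MapsTo ψ (polyDisc n) (polyDisc n))
    {c : ℝ} (hc : 0 < c)
    (h : ∀ δ > 0, ∃ z ∈ Eset n φ ψ δ, c ≤ ‖mobius n (φ z) (ψ z)‖) :
    ¬ IsCompactOp n (compOpDiff n φ ψ) := by
  rintro ⟨-, hmaps, hcomp⟩
  choose z hzE hzc using fun m : ℕ => h (1 / (m + 1)) Nat.one_div_pos_of_nat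
  have hex (m : ℕ) : ∃ f : (Fin n → ℂ) → ℂ, DifferentiableOn ℂ f (polyDisc n) ∧
      (∀ w ∈ polyDisc n, ‖f w‖ ≤ 2) ∧
      (∀ w ∈ polyDisc n, ‖f w‖ ≤ 2 * (1 / (m + 1)) / (1 - ‖w‖)) ∧
      c ≤ ‖f (φ (z m)) - f (ψ (z m))‖ := by
    have hmono {a : Fin n → ℂ} (ha : 1 - 1 / ((m : ℝ) + 1) < ‖a‖) {w : Fin n → ℂ}
        (hw : w ∈ polyDisc n) :
        2 * (1 - ‖a‖) / (1 - ‖w‖) ≤ 2 * (1 / (m + 1)) / (1 - ‖w‖) := by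
      have hw1 : ‖w‖ < 1 := hw
      exact div_le_div_of_nonneg_right (by linarith) (by linarith)
    rcases lt_max_iff.mp (hzE m).2 with hlt | hlt
    · obtain ⟨f, h1, h2, h3, h4⟩ :=
        exists_separating_function hn (hφm (hzE m).1) (hψm (hzE m).1)
      exact ⟨f, h1, h2, fun w hw => (h3 w hw).trans (hmono hlt hw), h4 ▸ hzc m⟩
    · obtain ⟨f, h1, h2, h3, h4⟩ :=
        exists_separating_function hn (hψm (hzE m).1) (hφm (hzE m).1)
      refine ⟨f, h1, h2, fun w hw => (h3 w hw).trans (hmono hlt hw), ?_⟩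
      rw [norm_sub_rev, h4, norm_mobius_comm]
      exact hzc m
  choose f hfd hf2 hfsmall hfc using hex
  set B : ℝ := 2 + n * (4 * 2) with hB
  have hB0 : 0 < B := by positivity
  have hfB (m : ℕ) := inBloch_of_norm_le (hfd m) zero_le_two (hf2 m)
  have hnormB : ‖((B⁻¹ : ℝ) : ℂ)‖ = B⁻¹ := Complex.norm_of_nonneg (by positivity)
  set F : ℕ → (Fin n → ℂ) → ℂ := fun m => ((B⁻¹ : ℝ) : ℂ) • f m with hFdef
  have hF (m : ℕ) : InBloch n (F m) ∧ blochNorm n (F m) ≤ 1 := by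
    obtain ⟨h1, h2⟩ := (hfB m).1.const_smul ((B⁻¹ : ℝ) : ℂ)
    refine ⟨h1, ?_⟩
    rw [h2, hnormB, inv_mul_le_one₀ hB0]
    exact (hfB m).2
  obtain ⟨s, hs, hcauchy⟩ := hcomp F hF
  obtain ⟨N, hN⟩ := hcauchy (B⁻¹ * c / 2) (by positivity)
  have hlim {w : Fin n → ℂ} (hw : w ∈ polyDisc n) :
      Tendsto (fun k => F (s k) w) atTop (𝓝 0) := by
    have h1 : Tendsto (fun m : ℕ => 2 * (1 / ((m : ℝ) + 1)) / (1 - ‖w‖)) atTop (𝓝 0) := by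
      simpa using (tendsto_one_div_add_atTop_nhds_zero_nat.const_mul 2).div_const (1 - ‖w‖)
    have h2 : Tendsto (fun m => f m w) atTop (𝓝 0) :=
      squeeze_zero_norm (fun m => hfsmall m w hw) h1
    have h3 := (h2.const_smul ((B⁻¹ : ℝ) : ℂ)).comp hs.tendsto_atTop
    rw [smul_zero] at h3
    exact h3
  have hzN := (hzE (s N)).1
  have hTlim : Tendsto (fun k => ‖(compOpDiff n φ ψ (F (s N)) - compOpDiff n φ ψ (F (s k)))
      (z (s N))‖) atTop (𝓝 ‖compOpDiff n φ ψ (F (s N)) (z (s N))‖) := by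
    have h1 := (hlim (hφm hzN)).sub (hlim (hψm hzN))
    have h2 := (h1.const_sub (compOpDiff n φ ψ (F (s N)) (z (s N)))).norm
    rw [sub_zero, sub_zero] at h2
    exact h2
  have hle : ‖compOpDiff n φ ψ (F (s N)) (z (s N))‖ ≤ B⁻¹ * c / 2 := by
    refine le_of_tendsto hTlim (eventually_atTop.mpr ⟨N, fun k hk => ?_⟩)
    refine (norm_le_supNorm ?_ hzN).trans (hN N le_rfl k hk)
    obtain ⟨C₁, h1⟩ := (hmaps _ (hF (s N)).1).2
    obtain ⟨C₂, h2⟩ := (hmaps _ (hF (s k)).1).2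
    refine ⟨C₁ + C₂, ?_⟩
    rintro _ ⟨w, hw, rfl⟩
    exact (norm_sub_le _ _).trans
      (add_le_add (h1 (mem_image_of_mem _ hw)) (h2 (mem_image_of_mem _ hw)))
  have hge : B⁻¹ * c ≤ ‖compOpDiff n φ ψ (F (s N)) (z (s N))‖ := by
    simp only [compOpDiff, hFdef, Pi.sub_apply, Function.comp_apply, Pi.smul_apply]
    rw [← smul_sub, norm_smul, hnormB]
    exact mul_le_mul_of_nonneg_left (hfc (s N)) (by positivity)
  have hpos : 0 < B⁻¹ * c := by positivity
  linarith

end Difference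

end Polydisc

/-- **Corollary: characterization of compact difference.** If `φ, ψ : Uⁿ → Uⁿ`
are holomorphic and `C_φ - C_ψ : B → H^∞` is bounded, then `C_φ - C_ψ` is compact if and
only if `lim_{δ→0⁺} sup_{z ∈ E_δ} |||φ_{φ(z)}(ψ(z))||| = 0` (the limit equals the infimum
over `δ > 0`, the supremum being monotone in `δ`). -/
theorem compact_diff_iff (n : ℕ) (hn : 0 < n)
    (φ ψ : (Fin n → ℂ) → Fin n → ℂ)
    (hφ : DifferentiableOn ℂ φ (polyDisc n)) (hφm : MapsTo φ (polyDisc n) (polyDisc n))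
    (hψ : DifferentiableOn ℂ ψ (polyDisc n)) (hψm : MapsTo ψ (polyDisc n) (polyDisc n))
    (hbdd : IsBddOp n (compOpDiff n φ ψ)) :
    IsCompactOp n (compOpDiff n φ ψ) ↔
      (⨅ δ : {d : ℝ // 0 < d},
        sSup ((fun z => ‖mobius n (φ z) (ψ z)‖) '' Eset n φ ψ (δ : ℝ))) = 0 := by
  have hnonneg (δ : {d : ℝ // 0 < d}) :
      0 ≤ sSup ((fun z => ‖mobius n (φ z) (ψ z)‖) '' Eset n φ ψ (δ : ℝ)) :=
    Real.sSup_nonneg <| by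
      rintro _ ⟨z, _, rfl⟩
      exact norm_nonneg _
  have : Nonempty {d : ℝ // 0 < d} := ⟨⟨1, one_pos⟩⟩
  constructor
  · intro hcomp
    by_contra hne
    have hpos := (Real.iInf_nonneg hnonneg).lt_of_ne' hne
    refine not_isCompactOp_compOpDiff hn hφm hψm (half_pos hpos) (fun δ hδ => ?_) hcomp
    have hle := ciInf_le ⟨0, forall_mem_range.mpr hnonneg⟩ (⟨δ, hδ⟩ : {d : ℝ // 0 < d})
    have hlt := (half_lt_self hpos).trans_le hle
    have himg : ((fun z => ‖mobius n (φ z) (ψ z)‖) '' Eset n φ ψ δ).Nonempty := by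
      by_contra hemp
      rw [not_nonempty_iff_eq_empty] at hemp
      simp only [hemp, Real.sSup_empty] at hle
      linarith
    obtain ⟨_, ⟨z, hz, rfl⟩, hzlt⟩ := exists_lt_of_lt_csSup himg hlt
    exact ⟨z, hz, hzlt.le⟩
  · intro h0
    refine isCompactOp_compOpDiff hφ hφm hψ hψm fun ε hε => ?_
    obtain ⟨⟨δ, hδ⟩, hlt⟩ := exists_lt_of_ciInf_lt (h0.trans_lt hε)
    exact ⟨δ, hδ, fun z hz =>
      (le_csSup (bddAbove_norm_mobius hφm hψm δ) (mem_image_of_mem _ hz)).trans hlt.le⟩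

end
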